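/- arXiv:2204.12524 — 3 statements merged into one kernel-verified Lean document; each statement's English description precedes it below -/
import Mathlib

section
/- Let g : ℝⁿ → ℝᵐ and h : ℝⁿ → ℝᵖ be twice continuously differentiable and let x̄ ∈ Ω be a feasible point at which the relaxed constant rank constraint qualification (RCRCQ) holds. Given any d̄ ∈ L(x̄) in the linearized cone, define J = { j ∈ I_g(x̄) : ∇g_j(x̄)ᵀ d̄ = 0 }. Then there exist δ > 0 and a twice continuously differentiable arc ζ : (−δ, δ) → ℝⁿ such that: (i) ζ(0) = x̄ and ζ'(0) = d̄; (ii) g_j(ζ(t)) = 0 for all t ∈ (−δ, δ) and all j ∈ J; (iii) g_j(ζ(t)) ≤ 0 for all t ∈ (−δ, δ) and all j ∉ I_g(x̄); (iv) g_j(ζ(t)) ≤ 0 for all t ∈ [0, δ) and all j ∈ I_g(x̄) \ J; and (v) h(ζ(t)) = 0 for all t ∈ (−δ, δ). In particular, ζ(t) ∈ Ω for all t ∈ [0, δ) and hence d̄ belongs to the tangent cone T(x̄). -/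
open Filter Topology Set

/-- The feasible set `Ω = {x : g(x) ≤ 0, h(x) = 0}` (componentwise). -/
def feasibleSet {n m p : ℕ} (g : (Fin n → ℝ) → Fin m → ℝ)
    (h : (Fin n → ℝ) → Fin p → ℝ) : Set (Fin n → ℝ) :=
  {x | (∀ i, g x i ≤ 0) ∧ ∀ j, h x j = 0}

/-- The relaxed constant rank constraint qualification (RCRCQ) at `xbar`:
for every subset `I` of the active inequality index set, the family of gradients
`{∇g_i(x) : i ∈ I} ∪ {∇h_j(x) : j = 1,…,p}` has the same rank for every `x` in some
neighborhood of `xbar`.  Gradients are represented as the derivative functionals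
`fderiv ℝ (g · i) x`. -/
def RCRCQ {n m p : ℕ} (g : (Fin n → ℝ) → Fin m → ℝ)
    (h : (Fin n → ℝ) → Fin p → ℝ) (xbar : Fin n → ℝ) : Prop :=
  ∀ I : Set (Fin m), I ⊆ {i | g xbar i = 0} →
    ∃ r : ℕ, ∀ᶠ x in 𝓝 xbar,
      Module.finrank ℝ (Submodule.span ℝ
        ((fun i => fderiv ℝ (fun y => g y i) x) '' I ∪
          Set.range (fun j => fderiv ℝ (fun y => h y j) x))) = r

/-- The linearized cone `L(xbar)`. -/
def linCone {n m p : ℕ} (g : (Fin n → ℝ) → Fin m → ℝ)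
    (h : (Fin n → ℝ) → Fin p → ℝ) (xbar : Fin n → ℝ) : Set (Fin n → ℝ) :=
  {d | (∀ i, g xbar i = 0 → fderiv ℝ (fun y => g y i) xbar d ≤ 0) ∧
    ∀ j, fderiv ℝ (fun y => h y j) xbar d = 0}

/-- The tangent cone to a set `Ω` at `xbar`:
`d` such that there are `x^k ∈ Ω` and `t_k > 0` with `t_k → 0` and `(x^k - xbar)/t_k → d`. -/
def seqTangentCone {n : ℕ} (Ω : Set (Fin n → ℝ)) (xbar : Fin n → ℝ) :
    Set (Fin n → ℝ) :=
  {d | ∃ (xs : ℕ → Fin n → ℝ) (ts : ℕ → ℝ), (∀ k, xs k ∈ Ω) ∧ (∀ k, 0 < ts k) ∧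
    Tendsto ts atTop (𝓝 0) ∧
    Tendsto (fun k => (ts k)⁻¹ • (xs k - xbar)) atTop (𝓝 d)}

/-- Linearly independent functionals are jointly surjective. -/
theorem LinearIndependent.range_pi_eq_top {E κ : Type*} [NormedAddCommGroup E] [NormedSpace ℝ E]
    [Finite κ] {φ : κ → E →L[ℝ] ℝ} (hφ : LinearIndependent ℝ φ) :
    (ContinuousLinearMap.pi φ).range = ⊤ := by
  classical
  cases nonempty_fintype κ
  by_contra hne
  obtain ⟨l, hl0, hl⟩ := Submodule.exists_le_ker_of_lt_top _ (lt_top_iff_ne_top.2 hne)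
  have hsum : ∑ k, l (Pi.single k 1) • φ k = 0 := by
    ext x
    have hx : l (ContinuousLinearMap.pi φ x) = 0 := hl ⟨x, rfl⟩
    rw [← Finset.univ_sum_single (ContinuousLinearMap.pi φ x), map_sum] at hx
    have hk : ∀ k, l (Pi.single k (φ k x)) = l (Pi.single k 1) * φ k x := fun k => by
      rw [mul_comm, ← smul_eq_mul, ← map_smul, ← Pi.single_smul, smul_eq_mul, mul_one]
    simpa [hk] using hx
  have hcoef := Fintype.linearIndependent_iff.1 hφ _ hsum
  refine hl0 (LinearMap.pi_ext' fun k => LinearMap.ext_ring ?_)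
  simpa using hcoef k

/-- A `C^n` submersion admits, in each kernel direction, a `C^n` arc in its level set. -/
theorem exists_contDiffAt_arc_of_range_eq_top {E F : Type*} [NormedAddCommGroup E]
    [NormedSpace ℝ E] [CompleteSpace E] [NormedAddCommGroup F] [NormedSpace ℝ F]
    [FiniteDimensional ℝ F] {N : WithTop ℕ∞} (hN : N ≠ 0) {f : E → F} {a : E}
    (hf : ContDiffAt ℝ N f a)
    (hsurj : (fderiv ℝ f a).range = ⊤) {d : E} (hd : fderiv ℝ f a d = 0) :
    ∃ ζ : ℝ → E, ContDiffAt ℝ N ζ 0 ∧ ζ 0 = a ∧ HasDerivAt ζ d 0 ∧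
      ∀ᶠ t in 𝓝 0, f (ζ t) = f a := by
  have := FiniteDimensional.complete ℝ F
  have hs := hf.hasStrictFDerivAt hN
  let e : ℝ →L[ℝ] (fderiv ℝ f a).ker :=
    ContinuousLinearMap.toSpanSingleton ℝ ⟨d, hd⟩
  let φ := hs.implicitFunctionDataOfComplemented f _ hsurj
    (fderiv ℝ f a).ker_closedComplemented_of_finiteDimensional_range
  have hφ : φ.prodFun φ.pt = (f a, 0) := by simp [φ]
  have hsm : ContDiffAt ℝ N φ.implicitFunction.uncurry (f a, 0) := by
    rw [← hφ]
    refine φ.contDiffAt_implicitFunction (by simpa [φ] using hf) ?_ hN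
    simp only [φ, HasStrictFDerivAt.implicitFunctionDataOfComplemented]
    exact (ContinuousLinearMap.contDiff _).contDiffAt.comp _ (contDiffAt_id.sub contDiffAt_const)
  have hpt : φ.implicitFunction (f a) 0 = a :=
    hs.implicitFunction_apply_image hsurj
  refine ⟨fun t => φ.implicitFunction (f a) (e t), ?_, ?_, ?_, ?_⟩
  · have hin : ContDiffAt ℝ N (fun t : ℝ => (f a, e t)) 0 :=
      contDiffAt_const.prodMk e.contDiff.contDiffAt
    have he : (f a, e 0) = (f a, 0) := by rw [map_zero]
    exact ContDiffAt.comp (0 : ℝ) (g := φ.implicitFunction.uncurry) (by rw [he]; exact hsm) hin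
  · simpa using hpt
  · have h1 : HasFDerivAt (φ.implicitFunction (f a)) (fderiv ℝ f a).ker.subtypeL (e 0) := by
      rw [map_zero]
      exact (hs.to_implicitFunction hsurj).hasFDerivAt
    have h2 := (h1.comp (0 : ℝ) e.hasFDerivAt).hasDerivAt
    simpa [e, Function.comp_def] using h2
  · have h1 : Tendsto (fun t : ℝ => (f a, e t)) (𝓝 0) (𝓝 (f a, 0)) :=
      tendsto_const_nhds.prodMk_nhds (by simpa using e.continuous.tendsto 0)
    exact h1.eventually (hs.map_implicitFunction_eq hsurj)

/-- A real function with derivative zero near a point is constant near it. -/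
theorem eventually_eq_of_eventually_hasDerivAt_zero {u : ℝ → ℝ} {t₀ : ℝ}
    (hu : ∀ᶠ t in 𝓝 t₀, HasDerivAt u 0 t) : ∀ᶠ t in 𝓝 t₀, u t = u t₀ := by
  obtain ⟨ε, hε, hb⟩ := Metric.eventually_nhds_iff_ball.1 hu
  filter_upwards [Metric.ball_mem_nhds t₀ hε] with t ht
  exact Metric.isOpen_ball.is_const_of_deriv_eq_zero (convex_ball t₀ ε).isPreconnected
    (fun x hx => (hb x hx).differentiableAt.differentiableWithinAt)
    (fun x hx => (hb x hx).deriv) ht (Metric.mem_ball_self hε)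

/-- If the gradients of finitely many `C^N` functions have constant rank near `a`, then every
direction annihilated by all of them at `a` is tangent to a `C^N` arc in the common level set. -/
theorem exists_contDiffAt_arc_of_constant_rank {E ι : Type*} [NormedAddCommGroup E]
    [NormedSpace ℝ E] [FiniteDimensional ℝ E] [Finite ι] {N : WithTop ℕ∞} (hN : N ≠ 0)
    {f : ι → E → ℝ} (hf : ∀ i, ContDiff ℝ N (f i)) {a : E} {r : ℕ}
    (hr : ∀ᶠ x in 𝓝 a,
      Module.finrank ℝ (Submodule.span ℝ (Set.range fun i => fderiv ℝ (f i) x)) = r)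
    {d : E} (hd : ∀ i, fderiv ℝ (f i) a d = 0) :
    ∃ ζ : ℝ → E, ContDiffAt ℝ N ζ 0 ∧ ζ 0 = a ∧ HasDerivAt ζ d 0 ∧
      ∀ i, ∀ᶠ t in 𝓝 0, f i (ζ t) = f i a := by
  have := FiniteDimensional.complete ℝ E
  have hdiff : ∀ i, Differentiable ℝ (f i) := fun i => (hf i).differentiable hN
  obtain ⟨κ, b, hb, hspan, hli⟩ :=
    exists_linearIndependent' ℝ (fun i => fderiv ℝ (f i) a)
  have : Finite κ := Finite.of_injective b hb
  cases nonempty_fintype κ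
  have hcard : Fintype.card κ = r := by
    rw [← finrank_span_eq_card hli, hspan, hr.self_of_nhds]
  have hspan_near : ∀ᶠ x in 𝓝 a, ∀ i, fderiv ℝ (f i) x ∈
      Submodule.span ℝ (Set.range fun k => fderiv ℝ (f (b k)) x) := by
    have hcont : Tendsto (fun x k => fderiv ℝ (f (b k)) x) (𝓝 a)
        (𝓝 fun k => fderiv ℝ (f (b k)) a) :=
      (continuous_pi fun k => (hf (b k)).continuous_fderiv hN).tendsto a
    filter_upwards [hr, hcont.eventually hli.eventually] with x hx hlix i
    have hle : Submodule.span ℝ (Set.range fun k => fderiv ℝ (f (b k)) x) ≤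
        Submodule.span ℝ (Set.range fun i => fderiv ℝ (f i) x) :=
      Submodule.span_mono (Set.range_comp_subset_range b fun i => fderiv ℝ (f i) x)
    rw [Submodule.eq_of_le_of_finrank_eq hle (by rw [finrank_span_eq_card hlix, hx, hcard])]
    exact Submodule.subset_span ⟨i, rfl⟩
  have hF : fderiv ℝ (fun x k => f (b k) x) a =
      ContinuousLinearMap.pi fun k => fderiv ℝ (f (b k)) a :=
    fderiv_pi fun k => hdiff (b k) a
  obtain ⟨ζ, hζ, hζ0, hζd, hζF⟩ := exists_contDiffAt_arc_of_range_eq_top hN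
    (f := fun x k => f (b k) x) (a := a) (d := d)
    (contDiff_pi.2 fun k => hf (b k)).contDiffAt
    (by rw [hF]; exact hli.range_pi_eq_top)
    (by rw [hF]; ext k; exact hd (b k))
  refine ⟨ζ, hζ, hζ0, hζd, fun i => ?_⟩
  rw [← hζ0]
  refine eventually_eq_of_eventually_hasDerivAt_zero (u := fun t => f i (ζ t)) ?_
  have hζdiff : ∀ᶠ t in 𝓝 (0 : ℝ), DifferentiableAt ℝ ζ t := by
    have h1 : ContDiffAt ℝ 1 ζ 0 := hζ.of_le (ENat.one_le_iff_ne_zero_withTop.2 hN)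
    exact (h1.eventually (by simp)).mono fun t ht => ht.differentiableAt (by simp)
  have hζt : Tendsto ζ (𝓝 0) (𝓝 a) := by
    simpa [hζ0] using hζ.continuousAt.tendsto
  filter_upwards [hζdiff, hζt.eventually hspan_near, hζF.eventually_nhds] with t ht hst hconst
  have hchain : ∀ j, HasDerivAt (fun s => f j (ζ s)) (fderiv ℝ (f j) (ζ t) (deriv ζ t)) t :=
    fun j => (hdiff j (ζ t)).hasFDerivAt.comp_hasDerivAt t ht.hasDerivAt
  have hker : ∀ ψ ∈ Submodule.span ℝ (Set.range fun k => fderiv ℝ (f (b k)) (ζ t)),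
      ψ (deriv ζ t) = 0 := by
    intro ψ hψ
    induction hψ using Submodule.span_induction with
    | mem ψ hψ =>
      obtain ⟨k, rfl⟩ := hψ
      refine (hchain (b k)).unique ((hasDerivAt_const t (f (b k) a)).congr_of_eventuallyEq ?_)
      exact hconst.mono fun s hs => congrFun hs k
    | zero => simp
    | add ψ₁ ψ₂ _ _ h₁ h₂ => simp [h₁, h₂]
    | smul c ψ _ h => simp [h]
  simpa [hker _ (hst i)] using hchain i

/-- The velocity of an arc that stays in `Ω` for small nonnegative times is tangent to `Ω`. -/
theorem mem_seqTangentCone_of_hasDerivAt {n : ℕ} {Ω : Set (Fin n → ℝ)} {ζ : ℝ → Fin n → ℝ}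
    {d : Fin n → ℝ} {δ : ℝ} (hδ : 0 < δ) (hζ : HasDerivAt ζ d 0)
    (hΩ : ∀ t ∈ Set.Ico 0 δ, ζ t ∈ Ω) : d ∈ seqTangentCone Ω (ζ 0) := by
  have hpos : ∀ k : ℕ, 0 < δ / ((k : ℝ) + 2) := fun k => by positivity
  have hlim : Tendsto (fun k : ℕ => δ / ((k : ℝ) + 2)) atTop (𝓝 0) :=
    tendsto_const_nhds.div_atTop
      (tendsto_atTop_add_const_right _ _ tendsto_natCast_atTop_atTop)
  refine ⟨fun k => ζ (δ / ((k : ℝ) + 2)), fun k => δ / ((k : ℝ) + 2),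
    fun k => hΩ _ ⟨(hpos k).le, ?_⟩, hpos, hlim, ?_⟩
  · exact div_lt_self hδ (by linarith [(Nat.cast_nonneg k : (0 : ℝ) ≤ k)])
  · have hslope := (hasDerivAt_iff_tendsto_slope_zero.1 hζ).comp
      (tendsto_nhdsWithin_iff.2 ⟨hlim, Eventually.of_forall fun k => (hpos k).ne'⟩)
    simpa [Function.comp_def] using hslope


/-- **Proposition (feasible arc under RCRCQ).** If RCRCQ holds at the feasible point
`xbar` and `dbar ∈ L(xbar)`, with `J = {j ∈ I_g(xbar) : ∇g_j(xbar)ᵀ dbar = 0}`, then there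
is a twice continuously differentiable arc `ζ : (−δ, δ) → ℝⁿ` with `ζ(0) = xbar`,
`ζ'(0) = dbar`, `g_j(ζ(t)) = 0` on `(−δ,δ)` for `j ∈ J`, `g_j(ζ(t)) ≤ 0` on `(−δ,δ)` for
inactive `j`, `g_j(ζ(t)) ≤ 0` on `[0,δ)` for `j ∈ I_g(xbar) \ J`, and `h(ζ(t)) = 0` on
`(−δ,δ)`; in particular `ζ(t) ∈ Ω` for `t ∈ [0,δ)` and `dbar ∈ T(xbar)`. -/
theorem feasible_arc_of_rcrcq (n m p : ℕ)
    (g : (Fin n → ℝ) → Fin m → ℝ) (h : (Fin n → ℝ) → Fin p → ℝ)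
    (hg : ContDiff ℝ 2 g) (hh : ContDiff ℝ 2 h)
    (xbar : Fin n → ℝ) (hxbar : xbar ∈ feasibleSet g h)
    (hcq : RCRCQ g h xbar)
    (dbar : Fin n → ℝ) (hdbar : dbar ∈ linCone g h xbar) :
    ∃ δ > (0:ℝ), ∃ ζ : ℝ → Fin n → ℝ,
      ContDiffOn ℝ 2 ζ (Set.Ioo (-δ) δ) ∧
      ζ 0 = xbar ∧ deriv ζ 0 = dbar ∧
      (∀ t ∈ Set.Ioo (-δ) δ, ∀ j, g xbar j = 0 →
        fderiv ℝ (fun y => g y j) xbar dbar = 0 → g (ζ t) j = 0) ∧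
      (∀ t ∈ Set.Ioo (-δ) δ, ∀ j, g xbar j ≠ 0 → g (ζ t) j ≤ 0) ∧
      (∀ t ∈ Set.Ico 0 δ, ∀ j, g xbar j = 0 →
        fderiv ℝ (fun y => g y j) xbar dbar ≠ 0 → g (ζ t) j ≤ 0) ∧
      (∀ t ∈ Set.Ioo (-δ) δ, ∀ j, h (ζ t) j = 0) ∧
      (∀ t ∈ Set.Ico 0 δ, ζ t ∈ feasibleSet g h) ∧
      dbar ∈ seqTangentCone (feasibleSet g h) xbar := by
  have hg' : ∀ i, ContDiff ℝ 2 fun y => g y i := fun i => contDiff_pi.1 hg i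
  have hh' : ∀ j, ContDiff ℝ 2 fun y => h y j := fun j => contDiff_pi.1 hh j
  let J : Set (Fin m) := {i | g xbar i = 0 ∧ fderiv ℝ (fun y => g y i) xbar dbar = 0}
  let f : J ⊕ Fin p → (Fin n → ℝ) → ℝ :=
    Sum.elim (fun i y => g y i) (fun j y => h y j)
  obtain ⟨r, hr⟩ := hcq J fun i hi => hi.1
  have hrange : ∀ x, Set.range (fun i => fderiv ℝ (f i) x) =
      (fun i => fderiv ℝ (fun y => g y i) x) '' J ∪
        Set.range (fun j => fderiv ℝ (fun y => h y j) x) := fun x => by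
    ext ψ
    simp [f]
  obtain ⟨ζ, hζ, hζ0, hζd, hζf⟩ := exists_contDiffAt_arc_of_constant_rank two_ne_zero
    (f := f) (a := xbar) (d := dbar) (r := r)
    (by rintro (i | j); exacts [hg' i, hh' j])
    (hr.mono fun x hx => by rw [hrange x]; exact hx)
    (by rintro (i | j); exacts [i.2.2, hdbar.2 j])
  have hcomp : ∀ i, ContinuousAt (fun t => g (ζ t) i) 0 := fun i =>
    (hg' i).continuous.continuousAt.comp hζ.continuousAt
  have hJ : ∀ᶠ t in 𝓝 (0 : ℝ), ∀ i, g xbar i = 0 →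
      fderiv ℝ (fun y => g y i) xbar dbar = 0 → g (ζ t) i = 0 := by
    simp only [eventually_all]
    exact fun i h0 hd => (hζf (.inl ⟨i, h0, hd⟩)).mono fun t ht => ht.trans h0
  have hinactive : ∀ᶠ t in 𝓝 (0 : ℝ), ∀ i, g xbar i ≠ 0 → g (ζ t) i ≤ 0 := by
    simp only [eventually_all]
    intro i hi
    have hlt : g (ζ 0) i < 0 := by
      rw [hζ0]
      exact (hxbar.1 i).lt_of_ne hi
    exact ((hcomp i).eventually (gt_mem_nhds hlt)).mono fun t ht => ht.le
  have hactive : ∀ᶠ t in 𝓝 (0 : ℝ), ∀ i, g xbar i = 0 →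
      fderiv ℝ (fun y => g y i) xbar dbar ≠ 0 → 0 ≤ t → g (ζ t) i ≤ 0 := by
    simp only [eventually_all]
    intro i h0 hd
    have hder : HasDerivAt (fun t => g (ζ t) i) (fderiv ℝ (fun y => g y i) xbar dbar) 0 := by
      rw [← hζ0]
      exact (((hg' i).differentiable two_ne_zero) (ζ 0)).hasFDerivAt.comp_hasDerivAt 0 hζd
    have hneg : deriv (fun t => g (ζ t) i) 0 < 0 := by
      rw [hder.deriv]
      exact (hdbar.1 i h0).lt_of_ne hd
    filter_upwards [eventually_nhdsWithin_sign_eq_of_deriv_neg hneg (by rw [hζ0, h0])]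
      with t hsign ht
    by_contra! hpos
    rw [sign_pos hpos, eq_comm, sign_eq_one_iff] at hsign
    linarith
  have heq : ∀ᶠ t in 𝓝 (0 : ℝ), ∀ j, h (ζ t) j = 0 := by
    rw [eventually_all]
    exact fun j => (hζf (.inr j)).mono fun t ht => ht.trans (hxbar.2 j)
  obtain ⟨δ, hδ, hb⟩ := Metric.eventually_nhds_iff_ball.1
    ((hζ.eventually (by simp)).and (hJ.and (hinactive.and (hactive.and heq))))
  simp only [Real.ball_eq_Ioo, zero_sub, zero_add] at hb
  have hsub : ∀ t ∈ Set.Ico 0 δ, t ∈ Set.Ioo (-δ) δ := fun t ht => ⟨by linarith [ht.1], ht.2⟩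
  have hfeas : ∀ t ∈ Set.Ico 0 δ, ζ t ∈ feasibleSet g h := by
    intro t ht
    obtain ⟨-, h1, h2, h3, h4⟩ := hb t (hsub t ht)
    refine ⟨fun i => ?_, h4⟩
    by_cases h0 : g xbar i = 0
    · by_cases hd : fderiv ℝ (fun y => g y i) xbar dbar = 0
      · exact (h1 i h0 hd).le
      · exact h3 i h0 hd ht.1
    · exact h2 i h0
  refine ⟨δ, hδ, ζ, fun t ht => (hb t ht).1.contDiffWithinAt, hζ0, hζd.deriv,
    fun t ht => (hb t ht).2.1, fun t ht => (hb t ht).2.2.1,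
    fun t ht j h0 hd => (hb t (hsub t ht)).2.2.2.1 j h0 hd ht.1,
    fun t ht => (hb t ht).2.2.2.2, hfeas, ?_⟩
  rw [← hζ0]
  exact mem_seqTangentCone_of_hasDerivAt hδ hζd hfeas
end

section
/- Let g : ℝⁿ → ℝᵐ and h : ℝⁿ → ℝᵖ be twice continuously differentiable and let x̄ ∈ Ω be a feasible point at which the relaxed constant rank constraint qualification (RCRCQ) holds. Then L(x̄) ⊆ T(x̄), i.e., every direction in the linearized cone belongs to the tangent cone to Ω at x̄; consequently the Abadie constraint qualification T(x̄) = L(x̄) holds at x̄. -/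
open Filter Topology Set

/-- A continuously differentiable map whose derivative at `x₀` has a right inverse admits, through
`x₀`, a `C¹` curve in its level set with any prescribed velocity in the kernel of the derivative. -/
theorem exists_curve_in_level_set {E W : Type*} [NormedAddCommGroup E] [NormedSpace ℝ E]
    [NormedAddCommGroup W] [NormedSpace ℝ W] [CompleteSpace W]
    {G : E → W} (hG : ContDiff ℝ 1 G) {x₀ d : E} {R : W →L[ℝ] E}
    (hR : ∀ w, fderiv ℝ G x₀ (R w) = w) (hd : fderiv ℝ G x₀ d = 0) :
    ∃ γ : ℝ → E, ContDiffAt ℝ 1 γ 0 ∧ HasDerivAt γ d 0 ∧ γ 0 = x₀ ∧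
      ∀ᶠ t in 𝓝 0, G (γ t) = G x₀ := by
  set Ψ : ℝ × W → ℝ × W := fun z => (z.1, G (x₀ + z.1 • d + R z.2)) with hΨ
  have hΨC : ContDiffAt ℝ 1 Ψ (0, 0) := by
    have : ContDiff ℝ 1 Ψ := by
      refine contDiff_fst.prodMk (hG.comp ?_)
      fun_prop
    exact this.contDiffAt
  have hΨ0 : Ψ (0, 0) = (0, G x₀) := by simp [hΨ]
  have hΨD : HasFDerivAt Ψ
      ((ContinuousLinearEquiv.refl ℝ (ℝ × W) : (ℝ × W) ≃L[ℝ] (ℝ × W)) : (ℝ × W) →L[ℝ] (ℝ × W))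
      (0, 0) := by
    have h1 : HasFDerivAt (fun z : ℝ × W => x₀ + z.1 • d + R z.2)
        ((ContinuousLinearMap.fst ℝ ℝ W).smulRight d + R.comp (ContinuousLinearMap.snd ℝ ℝ W))
        (0, 0) :=
      (((ContinuousLinearMap.fst ℝ ℝ W).smulRight d).hasFDerivAt.const_add x₀).add
        (R.comp (ContinuousLinearMap.snd ℝ ℝ W)).hasFDerivAt
    have h2 : HasFDerivAt G (fderiv ℝ G x₀) (x₀ + (0 : ℝ) • d + R 0) := by
      simpa using (hG.differentiable one_ne_zero x₀).hasFDerivAt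
    have h3 := (hasFDerivAt_fst (𝕜 := ℝ) (p := ((0 : ℝ), (0 : W)))).prodMk
      (HasFDerivAt.comp (x := ((0 : ℝ), (0 : W))) h2 h1)
    refine h3.congr_fderiv ?_
    ext z <;> simp [hR, hd]
  have hstrict := hΨC.hasStrictFDerivAt' hΨD one_ne_zero
  set S := hstrict.localInverse Ψ _ (0, 0)
  have hSC : ContDiffAt ℝ 1 S (0, G x₀) := hΨ0 ▸ hΨC.to_localInverse hΨD one_ne_zero
  have hS0 : S (0, G x₀) = (0, 0) := hΨ0 ▸ hstrict.localInverse_apply_image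
  have hSD : HasFDerivAt S (ContinuousLinearMap.id ℝ (ℝ × W)) (0, G x₀) := by
    have := hstrict.to_localInverse.hasFDerivAt
    rw [hΨ0] at this
    exact this
  have hSr : ∀ᶠ y in 𝓝 (0, G x₀), Ψ (S y) = y := hΨ0 ▸ hstrict.eventually_right_inverse
  have hι : HasDerivAt (fun t : ℝ => (t, G x₀)) ((1 : ℝ), (0 : W)) 0 :=
    (hasDerivAt_id _).prodMk (hasDerivAt_const _ _)
  have hu : HasDerivAt (fun t : ℝ => (S (t, G x₀)).2) 0 0 := by
    have h1 := hSD.comp_hasDerivAt (0 : ℝ) hι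
    exact (ContinuousLinearMap.snd ℝ ℝ W).hasFDerivAt.comp_hasDerivAt (0 : ℝ) h1
  refine ⟨fun t => x₀ + t • d + R (S (t, G x₀)).2, ?_, ?_, ?_, ?_⟩
  · have h1 : ContDiffAt ℝ 1 (fun t : ℝ => S (t, G x₀)) 0 :=
      ContDiffAt.comp (0 : ℝ) hSC (by fun_prop)
    have h2 : ContDiffAt ℝ 1 (fun t : ℝ => (S (t, G x₀)).2) 0 := h1.snd
    fun_prop
  · have h1 := (((hasDerivAt_id (0 : ℝ)).smul_const d).const_add x₀).add
      (R.hasFDerivAt.comp_hasDerivAt (0 : ℝ) hu)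
    simpa [Function.comp_def, Pi.add_def] using h1
  · simp [hS0]
  · have hc : Tendsto (fun t : ℝ => (t, G x₀)) (𝓝 0) (𝓝 (0, G x₀)) := hι.continuousAt
    filter_upwards [hc.eventually hSr] with t ht
    have h1 : (S (t, G x₀)).1 = t := congrArg Prod.fst ht
    have h2 := congrArg Prod.snd ht
    simpa only [hΨ, h1] using h2

/-- Linearly independent continuous functionals have a dual family of vectors, packaged as a
continuous right inverse of the evaluation map. -/
theorem LinearIndependent.exists_rightInverse_pi {E κ : Type*} [NormedAddCommGroup E]
    [NormedSpace ℝ E] [Finite κ] {φ : κ → E →L[ℝ] ℝ} (hφ : LinearIndependent ℝ φ) :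
    ∃ R : (κ → ℝ) →L[ℝ] E, ∀ w, ContinuousLinearMap.pi φ (R w) = w := by
  classical
  cases nonempty_fintype κ
  have hsurj : LinearMap.range (ContinuousLinearMap.pi φ : E →ₗ[ℝ] κ → ℝ) = ⊤ := by
    by_contra hne
    obtain ⟨f, hf0, hf⟩ := Submodule.exists_le_ker_of_lt_top _ (lt_top_iff_ne_top.2 hne)
    refine hf0 ?_
    have hsum : ∑ k, f (Pi.single k 1) • φ k = 0 := by
      ext x
      have hx : f (ContinuousLinearMap.pi φ x) = 0 := hf ⟨x, rfl⟩
      rw [pi_eq_sum_univ' (ContinuousLinearMap.pi φ x), map_sum] at hx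
      simpa [mul_comm, Pi.single_apply] using hx
    have hz := Fintype.linearIndependent_iff.1 hφ _ hsum
    refine LinearMap.pi_ext' fun k => ?_
    ext
    simpa using hz k
  obtain ⟨R, hR⟩ := LinearMap.exists_rightInverse_of_surjective _ hsurj
  exact ⟨LinearMap.toContinuousLinearMap R, fun w => LinearMap.congr_fun hR w⟩

/-- If finitely many `C¹` functions have gradients of locally constant rank at a common zero `x₀`,
every direction annihilated by the gradients at `x₀` is the velocity of a curve of common zeros. -/
theorem exists_curve_of_constant_rank {E ι : Type*} [NormedAddCommGroup E] [NormedSpace ℝ E]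
    [FiniteDimensional ℝ E] [Finite ι] {F : ι → E → ℝ} (hF : ∀ k, ContDiff ℝ 1 (F k))
    {x₀ d : E} {r : ℕ} (h0 : ∀ k, F k x₀ = 0) (hd : ∀ k, fderiv ℝ (F k) x₀ d = 0)
    (hr : ∀ᶠ x in 𝓝 x₀,
      Module.finrank ℝ (Submodule.span ℝ (range fun k => fderiv ℝ (F k) x)) = r) :
    ∃ γ : ℝ → E, HasDerivAt γ d 0 ∧ γ 0 = x₀ ∧ ∀ᶠ t in 𝓝 0, ∀ k, F k (γ t) = 0 := by
  obtain ⟨κ, a, ha, hspan, hli⟩ := exists_linearIndependent' ℝ fun k => fderiv ℝ (F k) x₀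
  have : Finite κ := Finite.of_injective a ha
  cases nonempty_fintype κ
  set G : E → κ → ℝ := fun x k => F (a k) x with hGdef
  have hG : ContDiff ℝ 1 G := contDiff_pi.2 fun k => hF (a k)
  have hG' : fderiv ℝ G x₀ = ContinuousLinearMap.pi fun k => fderiv ℝ (F (a k)) x₀ :=
    (hasFDerivAt_pi.2 fun k => ((hF (a k)).differentiable one_ne_zero x₀).hasFDerivAt).fderiv
  obtain ⟨R, hR⟩ := hli.exists_rightInverse_pi
  obtain ⟨γ, hγC, hγD, hγ0, hγG⟩ := exists_curve_in_level_set hG (x₀ := x₀) (d := d) (R := R)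
    (fun w => by rw [hG']; exact hR w) (by rw [hG']; ext k; exact hd (a k))
  have hcard : Fintype.card κ = r := by
    rw [← hr.self_of_nhds, ← hspan, finrank_span_eq_card hli]
  have hspan' : ∀ᶠ x in 𝓝 x₀, Submodule.span ℝ (range fun k => fderiv ℝ (F (a k)) x) =
      Submodule.span ℝ (range fun k => fderiv ℝ (F k) x) := by
    have hcont : ContinuousAt (fun x => fun k => fderiv ℝ (F (a k)) x) x₀ :=
      continuousAt_pi.2 fun k => ((hF (a k)).continuous_fderiv one_ne_zero).continuousAt
    filter_upwards [hr, hcont.eventually hli.eventually] with x hx hlix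
    refine Submodule.eq_of_le_of_finrank_eq (Submodule.span_mono ?_) ?_
    · rintro _ ⟨k, rfl⟩
      exact ⟨a k, rfl⟩
    · rw [hx, finrank_span_eq_card hlix, hcard]
  have hγdiff : ∀ᶠ t in 𝓝 (0 : ℝ), DifferentiableAt ℝ γ t :=
    (hγC.eventually (by simp)).mono fun t ht => ht.differentiableAt one_ne_zero
  have hγc : Tendsto γ (𝓝 0) (𝓝 x₀) := hγ0 ▸ hγD.continuousAt
  refine ⟨γ, hγD, hγ0, ?_⟩
  obtain ⟨ε, hε, hball⟩ := Metric.eventually_nhds_iff_ball.1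
    ((hγdiff.and (hγc.eventually hspan')).and hγG.eventually_nhds)
  filter_upwards [Metric.ball_mem_nhds (0 : ℝ) hε] with t ht k
  have hderiv : ∀ s ∈ Metric.ball (0 : ℝ) ε, HasDerivAt (fun s => F k (γ s)) 0 s := by
    intro s hs
    obtain ⟨⟨hγs, hsp⟩, hGs⟩ := hball s hs
    have hcomp : ∀ j, HasDerivAt (fun s => F j (γ s)) (fderiv ℝ (F j) (γ s) (deriv γ s)) s :=
      fun j => ((hF j).differentiable one_ne_zero (γ s)).hasFDerivAt.comp_hasDerivAt s
        hγs.hasDerivAt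
    have hzero : ∀ φ ∈ Submodule.span ℝ (range fun k => fderiv ℝ (F (a k)) (γ s)),
        φ (deriv γ s) = 0 := by
      intro φ hφ
      induction hφ using Submodule.span_induction with
      | mem φ hφ =>
        obtain ⟨j, rfl⟩ := hφ
        have hconst : (fun s => F (a j) (γ s)) =ᶠ[𝓝 s] fun _ => G x₀ j :=
          hGs.mono fun u hu => congrFun hu j
        exact (hcomp (a j)).unique ((hasDerivAt_const s _).congr_of_eventuallyEq hconst)
      | zero => simp
      | add φ ψ _ _ hφ hψ => simp [hφ, hψ]
      | smul c φ _ hφ => simp [hφ]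
    have := hcomp k
    rwa [hzero _ (hsp ▸ Submodule.subset_span ⟨k, rfl⟩)] at this
  have hconst := Metric.isOpen_ball.is_const_of_deriv_eq_zero
    (convex_ball (0 : ℝ) ε).isPreconnected
    (fun s hs => (hderiv s hs).differentiableAt.differentiableWithinAt)
    (fun s hs => (hderiv s hs).deriv) ht (Metric.mem_ball_self hε)
  rw [hconst, hγ0, h0]

theorem linCone_subset_seqTangentCone {n m p : ℕ} {g : (Fin n → ℝ) → Fin m → ℝ}
    {h : (Fin n → ℝ) → Fin p → ℝ} (hg : ContDiff ℝ 1 g) (hh : ContDiff ℝ 1 h)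
    {xbar : Fin n → ℝ} (hxbar : xbar ∈ feasibleSet g h) (hcq : RCRCQ g h xbar) :
    linCone g h xbar ⊆ seqTangentCone (feasibleSet g h) xbar := by
  rintro d ⟨hdg, hdh⟩
  have hgi : ∀ i, ContDiff ℝ 1 fun y => g y i := contDiff_pi.1 hg
  have hhj : ∀ j, ContDiff ℝ 1 fun y => h y j := contDiff_pi.1 hh
  set I : Set (Fin m) := {i | g xbar i = 0 ∧ fderiv ℝ (fun y => g y i) xbar d = 0}
  obtain ⟨r, hr⟩ := hcq I fun i hi => hi.1
  obtain ⟨γ, hγD, hγ0, hγ⟩ := exists_curve_of_constant_rank (x₀ := xbar) (d := d) (r := r)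
    (F := Sum.elim (fun (i : I) y => g y i) fun j y => h y j)
    (by rintro (i | j); exacts [hgi i, hhj j])
    (by rintro (i | j); exacts [i.2.1, hxbar.2 j])
    (by rintro (i | j); exacts [i.2.2, hdh j])
    (by
      filter_upwards [hr] with x hx
      have hset : (range fun k => fderiv ℝ
          ((Sum.elim (fun (i : I) y => g y i) fun j y => h y j : I ⊕ Fin p → _ → ℝ) k) x) =
          (fun i => fderiv ℝ (fun y => g y i) x) '' I ∪
            range fun j => fderiv ℝ (fun y => h y j) x := by
        ext φ
        simp
      rwa [hset])
  have hγc : ContinuousAt γ 0 := hγD.continuousAt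
  have hfeas : ∀ᶠ t in 𝓝[>] (0 : ℝ), γ t ∈ feasibleSet g h := by
    have hineq : ∀ i, ∀ᶠ t in 𝓝[>] (0 : ℝ), g (γ t) i ≤ 0 := by
      intro i
      by_cases hi : i ∈ I
      · exact (hγ.filter_mono nhdsWithin_le_nhds).mono fun t ht => (ht (Sum.inl ⟨i, hi⟩)).le
      by_cases hact : g xbar i = 0
      · have hneg : fderiv ℝ (fun y => g y i) (γ 0) d < 0 := by
          rw [hγ0]
          exact lt_of_le_of_ne (hdg i hact) fun h0 => hi ⟨hact, h0⟩
        have hD : HasDerivAt (fun t => g (γ t) i) (fderiv ℝ (fun y => g y i) (γ 0) d) 0 :=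
          ((hgi i).differentiable one_ne_zero (γ 0)).hasFDerivAt.comp_hasDerivAt (0 : ℝ) hγD
        have hslope := (hasDerivAt_iff_tendsto_slope.1 hD).mono_left
          (nhdsWithin_mono (0 : ℝ) fun t (ht : 0 < t) => ht.ne')
        filter_upwards [hslope.eventually (gt_mem_nhds hneg), self_mem_nhdsWithin] with t ht ht0
        have ht0 : (0 : ℝ) < t := ht0
        rw [slope_def_field, hγ0, hact, sub_zero, sub_zero, div_neg_iff] at ht
        rcases ht with ht | ht
        · exact absurd ht.2 ht0.not_gt
        · exact ht.1.le
      · have hlt : g (γ 0) i < 0 := by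
          rw [hγ0]
          exact lt_of_le_of_ne (hxbar.1 i) hact
        have hc : ContinuousAt (fun t => g (γ t) i) 0 :=
          ContinuousAt.comp (hgi i).continuous.continuousAt hγc
        exact ((hc.eventually (gt_mem_nhds hlt)).filter_mono nhdsWithin_le_nhds).mono
          fun t ht => ht.le
    filter_upwards [eventually_all.2 hineq, hγ.filter_mono nhdsWithin_le_nhds] with t ht ht'
    exact ⟨ht, fun j => ht' (Sum.inr j)⟩
  obtain ⟨ts, -, hts0, hts⟩ := exists_seq_strictAnti_tendsto (0 : ℝ)
  have htsw : Tendsto ts atTop (𝓝[>] 0) :=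
    tendsto_nhdsWithin_iff.2 ⟨hts, Eventually.of_forall hts0⟩
  obtain ⟨N, hN⟩ := eventually_atTop.1 (htsw.eventually hfeas)
  have hshift := htsw.comp (tendsto_add_atTop_nat N)
  refine ⟨fun k => γ (ts (k + N)), fun k => ts (k + N), fun k => hN _ (Nat.le_add_left _ _),
    fun k => hts0 _, hshift.mono_right nhdsWithin_le_nhds, ?_⟩
  have hslope := (hasDerivAt_iff_tendsto_slope.1 hγD).mono_left
    (nhdsWithin_mono (0 : ℝ) fun t (ht : 0 < t) => ht.ne')
  simpa [Function.comp_def, slope_def_module, hγ0] using hslope.comp hshift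

theorem seqTangentCone_subset_linCone {n m p : ℕ} {g : (Fin n → ℝ) → Fin m → ℝ}
    {h : (Fin n → ℝ) → Fin p → ℝ} {xbar : Fin n → ℝ} (hg : DifferentiableAt ℝ g xbar)
    (hh : DifferentiableAt ℝ h xbar) (hxbar : xbar ∈ feasibleSet g h) :
    seqTangentCone (feasibleSet g h) xbar ⊆ linCone g h xbar := by
  rintro d ⟨xs, ts, hxs, hts, hts0, hlim⟩
  have hzero : Tendsto (fun k => xs k - xbar) atTop (𝓝 0) := by
    have := hts0.smul hlim
    simpa [smul_smul, (hts _).ne'] using this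
  have hquot : ∀ f : (Fin n → ℝ) → ℝ, DifferentiableAt ℝ f xbar →
      Tendsto (fun k => (ts k)⁻¹ * (f (xs k) - f xbar)) atTop (𝓝 (fderiv ℝ f xbar d)) := by
    intro f hf
    simpa using (hasFDerivWithinAt_univ.2 hf.hasFDerivAt).lim hzero
      (Eventually.of_forall fun _ => mem_univ _) hlim
  refine ⟨fun i hi => ?_, fun j => ?_⟩
  · refine le_of_tendsto' (hquot _ (differentiableAt_pi.1 hg i)) fun k => ?_
    rw [hi, sub_zero]
    exact mul_nonpos_of_nonneg_of_nonpos (inv_pos.2 (hts k)).le ((hxs k).1 i)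
  · refine tendsto_nhds_unique (hquot _ (differentiableAt_pi.1 hh j)) ?_
    simp [(hxs _).2 j, hxbar.2 j]

/-- **Corollary (RCRCQ implies Abadie CQ).** If RCRCQ holds at the feasible point
`xbar`, then `L(xbar) ⊆ T(xbar)`; consequently the Abadie constraint qualification
`T(xbar) = L(xbar)` holds at `xbar`. -/
theorem rcrcq_implies_abadie (n m p : ℕ)
    (g : (Fin n → ℝ) → Fin m → ℝ) (h : (Fin n → ℝ) → Fin p → ℝ)
    (hg : ContDiff ℝ 2 g) (hh : ContDiff ℝ 2 h)
    (xbar : Fin n → ℝ) (hxbar : xbar ∈ feasibleSet g h)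
    (hcq : RCRCQ g h xbar) :
    linCone g h xbar ⊆ seqTangentCone (feasibleSet g h) xbar ∧
    seqTangentCone (feasibleSet g h) xbar = linCone g h xbar := by
  have hsub : linCone g h xbar ⊆ seqTangentCone (feasibleSet g h) xbar :=
    linCone_subset_seqTangentCone (hg.of_le one_le_two) (hh.of_le one_le_two) hxbar hcq
  exact ⟨hsub, (seqTangentCone_subset_linCone (hg.differentiable two_ne_zero xbar)
    (hh.differentiable two_ne_zero xbar) hxbar).antisymm hsub⟩
end

section
/- Let f : ℝⁿ → ℝ, g : ℝⁿ → ℝᵐ and h : ℝⁿ → ℝᵖ be twice continuously differentiable, and let x* ∈ Ω be a local minimizer of f over Ω at which the relaxed constant rank constraint qualification (RCRCQ) holds. Then there exists a Lagrange multiplier vector (μ, λ) ∈ ℝᵐ × ℝᵖ satisfying the KKT conditions at x*: ∇f(x*) + Σᵢ μᵢ ∇gᵢ(x*) + Σⱼ λⱼ ∇hⱼ(x*) = 0, μ ≥ 0, and μᵀg(x*) = 0. In other words, RCRCQ is a constraint qualification. -/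
open Filter Topology Set

/-- **Farkas lemma**: a functional that is nonpositive wherever finitely many given functionals
are nonpositive is a nonnegative combination of them. -/
theorem exists_nonneg_sum_smul_eq_of_forall_nonpos {V ι : Type*} [AddCommGroup V] [Module ℝ V]
    (s : Finset ι) (A : ι → V →ₗ[ℝ] ℝ) (γ : V →ₗ[ℝ] ℝ)
    (H : ∀ x, (∀ i ∈ s, A i x ≤ 0) → γ x ≤ 0) :
    ∃ c : ι → ℝ, (∀ i, 0 ≤ c i) ∧ γ = ∑ i ∈ s, c i • A i := by
  classical
  induction s using Finset.induction_on generalizing A γ with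
  | empty =>
    refine ⟨0, fun _ => le_rfl, LinearMap.ext fun x => le_antisymm (by simpa using H x) ?_⟩
    simpa using H (-x)
  | insert a s ha ih =>
    by_cases hs : ∀ x, (∀ i ∈ s, A i x ≤ 0) → γ x ≤ 0
    · obtain ⟨c, hc, hγ⟩ := ih A γ hs
      refine ⟨Function.update c a 0, fun i => ?_, ?_⟩
      · by_cases h : i = a <;> simp [h, hc]
      · rw [Finset.sum_insert ha, hγ, Function.update_self, zero_smul, zero_add]
        refine Finset.sum_congr rfl fun i hi => ?_
        rw [Function.update_of_ne (ne_of_mem_of_not_mem hi ha)]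
    · push Not at hs
      obtain ⟨z, hz, hγz⟩ := hs
      have haz : 0 < A a z := by
        by_contra! hle
        exact hγz.not_ge (H z (by simpa [hle] using hz))
      set k := (A a z)⁻¹ with hk
      have hk0 : 0 < k := inv_pos.2 haz
      have hkz : k * A a z = 1 := inv_mul_cancel₀ haz.ne'
      obtain ⟨c, hc, hγ⟩ := ih (fun i => A i - (k * A i z) • A a) (γ - (k * γ z) • A a) (by
        intro x hx
        have := H (x - (k * A a x) • z) (by
          intro i hi
          rcases Finset.mem_insert.1 hi with rfl | hi
          · simp only [map_sub, map_smul, smul_eq_mul]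
            have : k * A i x * A i z = A i x := by rw [mul_right_comm, hkz, one_mul]
            linarith
          · have := hx i hi
            simp only [map_sub, map_smul, smul_eq_mul, LinearMap.sub_apply,
              LinearMap.smul_apply] at this ⊢
            linarith)
        simp only [map_sub, map_smul, smul_eq_mul, LinearMap.sub_apply,
          LinearMap.smul_apply] at this ⊢
        linarith)
      refine ⟨Function.update c a (k * γ z - ∑ i ∈ s, c i * (k * A i z)), fun i => ?_, ?_⟩
      · by_cases h : i = a
        · subst h
          rw [Function.update_self, sub_nonneg]
          refine (Finset.sum_nonpos fun j hj => ?_).trans (mul_pos hk0 hγz).le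
          exact mul_nonpos_of_nonneg_of_nonpos (hc j)
            (mul_nonpos_of_nonneg_of_nonpos hk0.le (hz j hj))
        · simpa [Function.update_apply, h] using hc i
      · rw [Finset.sum_insert ha, Function.update_self]
        have : ∑ i ∈ s, Function.update c a (k * γ z - ∑ i ∈ s, c i * (k * A i z)) i • A i
            = ∑ i ∈ s, c i • A i := Finset.sum_congr rfl fun i hi => by
          rw [Function.update_of_ne (ne_of_mem_of_not_mem hi ha)]
        rw [this]
        refine (eq_add_of_sub_eq hγ).trans (LinearMap.ext fun x => ?_)
        simp only [LinearMap.add_apply, LinearMap.sum_apply, LinearMap.smul_apply,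
          LinearMap.sub_apply, smul_eq_mul, mul_sub, Finset.sum_sub_distrib, sub_mul,
          Finset.sum_mul, mul_assoc]
        ring

/-- Linearly independent functionals are jointly surjective. -/
theorem LinearIndependent.pi_surjective {V κ : Type*} [AddCommGroup V] [Module ℝ V] [Fintype κ]
    {v : κ → V →ₗ[ℝ] ℝ} (hv : LinearIndependent ℝ v) :
    Function.Surjective (LinearMap.pi v) := by
  classical
  rw [← LinearMap.range_eq_top]
  by_contra hne
  obtain ⟨φ, hφ, hle⟩ := Submodule.exists_le_ker_of_lt_top _ (lt_top_iff_ne_top.2 hne)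
  refine hφ (LinearMap.pi_ext' fun k => LinearMap.ext_ring ?_)
  refine Fintype.linearIndependent_iff.1 hv (fun k => φ (Pi.single k 1)) (LinearMap.ext fun x => ?_) k
  have h0 : φ (LinearMap.pi v x) = 0 := hle ⟨x, rfl⟩
  rw [LinearMap.pi_apply_eq_sum_univ φ] at h0
  have hsingle (k : κ) : (fun j => if k = j then (1 : ℝ) else 0) = Pi.single k 1 := by
    ext j
    simp [Pi.single_apply, eq_comm]
  simpa [LinearMap.sum_apply, mul_comm, hsingle] using h0


/-- A submersion-type system `F = 0` admits a `C¹` curve of solutions through a given solution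
with any prescribed velocity in the kernel of the derivative. -/
theorem exists_contDiffAt_curve_of_linearIndependent {E κ : Type*} [NormedAddCommGroup E]
    [NormedSpace ℝ E] [FiniteDimensional ℝ E] [Finite κ] {F : κ → E → ℝ} {x₀ d : E}
    (hF : ∀ k, ContDiff ℝ 1 (F k)) (h0 : ∀ k, F k x₀ = 0)
    (hli : LinearIndependent ℝ fun k => fderiv ℝ (F k) x₀)
    (hd : ∀ k, fderiv ℝ (F k) x₀ d = 0) :
    ∃ γ : ℝ → E, γ 0 = x₀ ∧ ContDiffAt ℝ 1 γ 0 ∧ HasDerivAt γ d 0 ∧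
      ∀ᶠ t in 𝓝 0, ∀ k, F k (γ t) = 0 := by
  classical
  have := Fintype.ofFinite κ
  have := FiniteDimensional.complete ℝ E
  set A : κ → E →L[ℝ] ℝ := fun k => fderiv ℝ (F k) x₀
  have hli' : LinearIndependent ℝ fun k => (A k : E →ₗ[ℝ] ℝ) :=
    hli.map' (ContinuousLinearMap.coeLM ℝ) (LinearMap.ker_eq_bot.2 ContinuousLinearMap.coe_injective)
  obtain ⟨R, hR⟩ := LinearMap.exists_rightInverse_of_surjective _
    (LinearMap.range_eq_top.2 hli'.pi_surjective)
  have hR' (w : κ → ℝ) (k : κ) : A k (R w) = w k := congrFun (LinearMap.congr_fun hR w) k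
  set Rc : (κ → ℝ) →L[ℝ] E := LinearMap.toContinuousLinearMap R
  set G : E → E := fun x => x + Rc (fun k => F k x - A k (x - x₀)) with hG
  have hG0 : G x₀ = x₀ := by
    have : (fun k => F k x₀ - A k (x₀ - x₀)) = 0 := by ext k; simp [h0]
    rw [hG]
    simp only [this, map_zero, add_zero]
  have hGc : ContDiffAt ℝ 1 G x₀ := by
    refine ContDiff.contDiffAt ?_
    have (k : κ) : ContDiff ℝ 1 fun x => F k x - A k (x - x₀) :=
      (hF k).sub ((A k).contDiff.comp (contDiff_id.sub contDiff_const))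
    exact contDiff_id.add (Rc.contDiff.comp (contDiff_pi.2 this))
  have hGd : HasFDerivAt G ((ContinuousLinearEquiv.refl ℝ E : E ≃L[ℝ] E) : E →L[ℝ] E) x₀ := by
    have h1 (k : κ) : HasFDerivAt (fun x => F k x - A k (x - x₀)) (0 : E →L[ℝ] ℝ) x₀ := by
      have h2 : HasFDerivAt (F k) (A k) x₀ := ((hF k).differentiable one_ne_zero x₀).hasFDerivAt
      have h3 : HasFDerivAt (fun x => A k (x - x₀)) (A k) x₀ := by
        have h := (A k).hasFDerivAt.comp x₀ ((hasFDerivAt_id x₀).sub_const x₀)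
        rw [ContinuousLinearMap.comp_id] at h
        exact h
      exact sub_self (A k) ▸ h2.sub h3
    have h4 := (hasFDerivAt_id x₀).add (Rc.hasFDerivAt.comp x₀ (hasFDerivAt_pi.2 h1))
    have h5 : ((ContinuousLinearEquiv.refl ℝ E : E ≃L[ℝ] E) : E →L[ℝ] E) =
        ContinuousLinearMap.id ℝ E + Rc.comp (ContinuousLinearMap.pi fun _ => 0) := by
      ext v
      have : (ContinuousLinearMap.pi fun _ : κ => (0 : E →L[ℝ] ℝ)) v = 0 := rfl
      simp [this]
    rw [h5]
    exact h4
  have hGs := hGc.hasStrictFDerivAt' hGd one_ne_zero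
  have hinv := hGc.to_localInverse hGd one_ne_zero
  have hinvd := hGs.to_localInverse.hasFDerivAt
  have hright := hGs.eventually_right_inverse
  have hinv0 := hGs.localInverse_apply_image
  change ContDiffAt ℝ 1 (hGs.localInverse G _ x₀) _ at hinv
  set Φ : E → E := hGs.localInverse G _ x₀
  rw [hG0] at hinv hinvd hright hinv0
  have hl0 : x₀ + (0 : ℝ) • d = x₀ := by simp
  have hlc : ContDiff ℝ 1 fun t : ℝ => x₀ + t • d :=
    contDiff_const.add (contDiff_id.smul contDiff_const)
  have hld : HasDerivAt (fun t : ℝ => x₀ + t • d) d 0 := by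
    simpa using ((hasDerivAt_id (0 : ℝ)).smul_const d).const_add x₀
  refine ⟨fun t => Φ (x₀ + t • d), by simp [hinv0], ?_, ?_, ?_⟩
  · exact ContDiffAt.comp (g := Φ) (0 : ℝ) (by rwa [hl0]) hlc.contDiffAt
  · rw [← hl0] at hinvd
    exact hinvd.comp_hasDerivAt (0 : ℝ) hld
  · have ht : Tendsto (fun t : ℝ => x₀ + t • d) (𝓝 0) (𝓝 x₀) := by
      have := hlc.continuous.tendsto 0
      rwa [hl0] at this
    filter_upwards [ht.eventually hright] with t h k
    have h5 := congrArg (A k) h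
    have hdk : A k d = 0 := hd k
    have h6 (w : κ → ℝ) : A k (Rc w) = w k := hR' w k
    simp only [hG, map_add, map_sub, h6, map_smul, hdk, smul_zero] at h5
    linarith

/-- Constant rank version: every kernel direction of a system whose gradients have locally
constant rank is the velocity of a curve of solutions. -/
theorem exists_curve_of_eventually_finrank_eq {E ι : Type*} [NormedAddCommGroup E]
    [NormedSpace ℝ E] [FiniteDimensional ℝ E] [Finite ι] {G : ι → E → ℝ} {x₀ d : E} {r : ℕ}
    (hG : ∀ a, ContDiff ℝ 1 (G a)) (h0 : ∀ a, G a x₀ = 0)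
    (hr : ∀ᶠ x in 𝓝 x₀,
      Module.finrank ℝ (Submodule.span ℝ (range fun a => fderiv ℝ (G a) x)) = r)
    (hd : ∀ a, fderiv ℝ (G a) x₀ d = 0) :
    ∃ γ : ℝ → E, γ 0 = x₀ ∧ HasDerivAt γ d 0 ∧ ∀ᶠ t in 𝓝 0, ∀ a, G a (γ t) = 0 := by
  obtain ⟨κ, b, hb, hspan, hli⟩ := exists_linearIndependent' ℝ fun a => fderiv ℝ (G a) x₀
  have : Finite κ := Finite.of_injective b hb
  have := Fintype.ofFinite κ
  obtain ⟨γ, hγ0, hγc, hγd, hγF⟩ := exists_contDiffAt_curve_of_linearIndependent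
    (F := fun k => G (b k)) (fun k => hG _) (fun k => h0 _) hli (fun k => hd _)
  refine ⟨γ, hγ0, hγd, ?_⟩
  have hcont : Continuous fun x => fun k => fderiv ℝ (G (b k)) x :=
    continuous_pi fun k => (hG (b k)).continuous_fderiv one_ne_zero
  have hli_near : ∀ᶠ x in 𝓝 x₀, LinearIndependent ℝ fun k => fderiv ℝ (G (b k)) x :=
    hcont.continuousAt.eventually hli.eventually
  have hspan_near : ∀ᶠ x in 𝓝 x₀, Submodule.span ℝ (range fun k => fderiv ℝ (G (b k)) x) =
      Submodule.span ℝ (range fun a => fderiv ℝ (G a) x) := by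
    filter_upwards [hli_near, hr] with x hx hrx
    refine Submodule.eq_of_le_of_finrank_eq (Submodule.span_mono ?_) ?_
    · rintro _ ⟨k, rfl⟩
      exact ⟨b k, rfl⟩
    · rw [hrx, ← hr.self_of_nhds, ← hspan, finrank_span_eq_card hx, finrank_span_eq_card hli]
  have hγt : Tendsto γ (𝓝 0) (𝓝 x₀) := hγ0 ▸ hγc.continuousAt
  have hγdiff : ∀ᶠ t in 𝓝 (0 : ℝ), DifferentiableAt ℝ γ t :=
    (hγc.eventually (by simp)).mono fun t ht => ht.differentiableAt one_ne_zero
  have hderiv : ∀ᶠ t in 𝓝 (0 : ℝ), ∀ a, HasDerivAt (fun s => G a (γ s)) 0 t := by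
    filter_upwards [hγt.eventually hspan_near, hγdiff, hγF.eventually_nhds] with t hst hdt hFt a
    have hchain (a : ι) :
        HasDerivAt (fun s => G a (γ s)) (fderiv ℝ (G a) (γ t) (deriv γ t)) t :=
      (((hG a).differentiable one_ne_zero _).hasFDerivAt).comp_hasDerivAt t hdt.hasDerivAt
    have hker : Submodule.span ℝ (range fun k => fderiv ℝ (G (b k)) (γ t)) ≤
        LinearMap.ker (ContinuousLinearMap.apply ℝ ℝ (deriv γ t) : (E →L[ℝ] ℝ) →ₗ[ℝ] ℝ) := by
      rw [Submodule.span_le]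
      rintro _ ⟨k, rfl⟩
      have : (fun s => G (b k) (γ s)) =ᶠ[𝓝 t] fun _ => 0 := hFt.mono fun s hs => hs k
      exact (hchain (b k)).unique ((hasDerivAt_const t (0 : ℝ)).congr_of_eventuallyEq this)
    have hzero : fderiv ℝ (G a) (γ t) (deriv γ t) = 0 :=
      hker (hst ▸ Submodule.subset_span ⟨a, rfl⟩)
    exact hzero ▸ hchain a
  obtain ⟨ε, hε, hball⟩ := Metric.eventually_nhds_iff_ball.1 hderiv
  filter_upwards [Metric.ball_mem_nhds 0 hε] with t ht a
  have := Metric.isOpen_ball.is_const_of_deriv_eq_zero (𝕜 := ℝ) (f := fun s => G a (γ s))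
    (convex_ball (0 : ℝ) ε).isPreconnected
    (fun s hs => (hball s hs a).differentiableAt.differentiableWithinAt)
    (fun s hs => (hball s hs a).deriv) ht (Metric.mem_ball_self hε)
  simpa [hγ0, h0] using this

/-- A function with negative derivative is eventually smaller to the right of the base point. -/
theorem HasDerivAt.eventually_nhdsGT_lt {φ : ℝ → ℝ} {φ' a : ℝ} (hφ : HasDerivAt φ φ' a)
    (hneg : φ' < 0) : ∀ᶠ t in 𝓝[>] a, φ t < φ a := by
  have hslope : ∀ᶠ t in 𝓝[>] a, slope φ a t < 0 :=
    (hφ.tendsto_slope.mono_left (nhdsWithin_mono _ fun _ ht => ne_of_gt ht)).eventually_lt_const hneg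
  filter_upwards [hslope, self_mem_nhdsWithin] with t ht hta
  rw [slope_def_field, div_neg_iff] at ht
  have : 0 < t - a := sub_pos.2 hta
  rcases ht with ht | ht <;> linarith

/-- Under RCRCQ a local minimizer has no linearized feasible descent direction. -/
theorem fderiv_nonneg_of_rcrcq {n m p : ℕ} {f : (Fin n → ℝ) → ℝ} {g : (Fin n → ℝ) → Fin m → ℝ}
    {h : (Fin n → ℝ) → Fin p → ℝ} {xs : Fin n → ℝ}
    (hf : DifferentiableAt ℝ f xs) (hg : ContDiff ℝ 1 g) (hh : ContDiff ℝ 1 h)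
    (hxs : xs ∈ feasibleSet g h) (hmin : IsLocalMinOn f (feasibleSet g h) xs)
    (hcq : RCRCQ g h xs) {d : Fin n → ℝ}
    (hdg : ∀ i, g xs i = 0 → fderiv ℝ (fun y => g y i) xs d ≤ 0)
    (hdh : ∀ j, fderiv ℝ (fun y => h y j) xs d = 0) : 0 ≤ fderiv ℝ f xs d := by
  set I : Set (Fin m) := {i | g xs i = 0 ∧ fderiv ℝ (fun y => g y i) xs d = 0}
  obtain ⟨r, hr⟩ := hcq I fun i hi => hi.1
  set G : I ⊕ Fin p → (Fin n → ℝ) → ℝ := Sum.elim (fun i x => g x i) fun j x => h x j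
  have hgi (i : Fin m) : ContDiff ℝ 1 fun x => g x i := contDiff_pi.1 hg i
  have hhj (j : Fin p) : ContDiff ℝ 1 fun x => h x j := contDiff_pi.1 hh j
  obtain ⟨γ, hγ0, hγd, hγG⟩ := exists_curve_of_eventually_finrank_eq (G := G) (x₀ := xs) (d := d)
    (r := r) (by rintro (i | j); exacts [hgi i, hhj j])
    (by rintro (i | j); exacts [i.2.1, hxs.2 j])
    (by
      refine hr.mono fun x hx => ?_
      rw [← hx]
      have : (range fun a => fderiv ℝ (G a) x) = (fun i => fderiv ℝ (fun y => g y i) x) '' I ∪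
          range fun j => fderiv ℝ (fun y => h y j) x := by
        ext v
        simp [G, Sum.exists]
      rw [this])
    (by rintro (i | j); exacts [i.2.2, hdh j])
  have hγt : Tendsto γ (𝓝[>] 0) (𝓝 xs) :=
    (hγ0 ▸ hγd.continuousAt.tendsto : Tendsto γ (𝓝 0) (𝓝 xs)).mono_left nhdsWithin_le_nhds
  have hcomp {φ : (Fin n → ℝ) → ℝ} (hφ : DifferentiableAt ℝ φ xs) :
      HasDerivAt (fun t => φ (γ t)) (fderiv ℝ φ xs d) 0 := by
    rw [← hγ0] at hφ ⊢
    exact hφ.hasFDerivAt.comp_hasDerivAt 0 hγd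
  have hineq : ∀ᶠ t in 𝓝[>] (0 : ℝ), ∀ i, g (γ t) i ≤ 0 := by
    refine eventually_all.2 fun i => ?_
    rcases (hxs.1 i).lt_or_eq with hlt | heq
    · exact (hγt.eventually ((hgi i).continuous.continuousAt.eventually_lt_const hlt)).mono
        fun _ => le_of_lt
    rcases (hdg i heq).lt_or_eq with hlt | hdeq
    · refine ((hcomp ((hgi i).differentiable one_ne_zero xs)).eventually_nhdsGT_lt hlt).mono
        fun t ht => ?_
      rw [hγ0, heq] at ht
      exact ht.le
    · exact (hγG.filter_mono nhdsWithin_le_nhds).mono fun t ht =>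
        (ht (Sum.inl ⟨i, heq, hdeq⟩)).le
  have hfeas : ∀ᶠ t in 𝓝[>] (0 : ℝ), γ t ∈ feasibleSet g h := by
    filter_upwards [hineq, hγG.filter_mono nhdsWithin_le_nhds] with t hgt hGt
    exact ⟨hgt, fun j => hGt (Sum.inr j)⟩
  by_contra! hneg
  have hlt := (hcomp hf).eventually_nhdsGT_lt hneg
  have hge := (tendsto_nhdsWithin_iff.2 ⟨hγt, hfeas⟩).eventually hmin
  obtain ⟨t, ht1, ht2⟩ := (hlt.and hge).exists
  rw [hγ0] at ht1
  exact ht1.not_ge ht2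

/-- **Theorem (RCRCQ is a constraint qualification).** If `x✶ ∈ Ω` is a local
minimizer of `f` over `Ω` at which RCRCQ holds, then there exist Lagrange multipliers
`(μ, lam)` with `∇f(x✶) + Σᵢ μᵢ∇gᵢ(x✶) + Σⱼ lamⱼ∇hⱼ(x✶) = 0`, `μ ≥ 0`, and
`μᵀg(x✶) = 0`. -/
theorem kkt_of_rcrcq (n m p : ℕ)
    (f : (Fin n → ℝ) → ℝ) (g : (Fin n → ℝ) → Fin m → ℝ) (h : (Fin n → ℝ) → Fin p → ℝ)
    (hf : ContDiff ℝ 2 f) (hg : ContDiff ℝ 2 g) (hh : ContDiff ℝ 2 h)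
    (xs : Fin n → ℝ) (hxs : xs ∈ feasibleSet g h)
    (hmin : IsLocalMinOn f (feasibleSet g h) xs)
    (hcq : RCRCQ g h xs) :
    ∃ (μ : Fin m → ℝ) (lam : Fin p → ℝ),
      (fderiv ℝ f xs + ∑ i, μ i • fderiv ℝ (fun y => g y i) xs +
        ∑ j, lam j • fderiv ℝ (fun y => h y j) xs = 0) ∧
      (∀ i, 0 ≤ μ i) ∧ (∑ i, μ i * g xs i = 0) := by
  classical
  obtain ⟨c, hc, hγ⟩ := exists_nonneg_sum_smul_eq_of_forall_nonpos Finset.univ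
    (Sum.elim (fun i => if g xs i = 0 then (fderiv ℝ (fun y => g y i) xs : (Fin n → ℝ) →ₗ[ℝ] ℝ) else 0)
      (Sum.elim (fun j => (fderiv ℝ (fun y => h y j) xs : (Fin n → ℝ) →ₗ[ℝ] ℝ))
        fun j => -(fderiv ℝ (fun y => h y j) xs : (Fin n → ℝ) →ₗ[ℝ] ℝ)))
    (-(fderiv ℝ f xs : (Fin n → ℝ) →ₗ[ℝ] ℝ)) (by
      intro d hd
      simp only [LinearMap.neg_apply, ContinuousLinearMap.coe_coe, neg_nonpos]
      refine fderiv_nonneg_of_rcrcq (hf.differentiable two_ne_zero xs) (hg.of_le one_le_two)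
        (hh.of_le one_le_two) hxs hmin hcq (fun i hi => ?_) fun j => le_antisymm ?_ ?_
      · simpa [hi] using hd (Sum.inl i) (Finset.mem_univ _)
      · simpa using hd (Sum.inr (Sum.inl j)) (Finset.mem_univ _)
      · simpa using hd (Sum.inr (Sum.inr j)) (Finset.mem_univ _))
  refine ⟨fun i => if g xs i = 0 then c (Sum.inl i) else 0,
    fun j => c (Sum.inr (Sum.inl j)) - c (Sum.inr (Sum.inr j)), ?_, fun i => ?_, ?_⟩
  · ext1 v
    have hv := LinearMap.congr_fun hγ v
    simp only [Fintype.sum_sum_type, Sum.elim_inl, Sum.elim_inr, smul_neg, smul_ite, smul_zero,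
      Finset.sum_neg_distrib, LinearMap.add_apply, LinearMap.neg_apply, LinearMap.sum_apply,
      LinearMap.smul_apply, ContinuousLinearMap.coe_coe, smul_eq_mul] at hv
    simp only [add_apply, zero_apply, _root_.sum_apply,
      smul_apply, smul_eq_mul, sub_mul, Finset.sum_sub_distrib, ite_mul,
      zero_mul]
    have hite (i : Fin m) :
        (if g xs i = 0 then c (Sum.inl i) • (fderiv ℝ (fun y => g y i) xs : (Fin n → ℝ) →ₗ[ℝ] ℝ) else 0) v =
          if g xs i = 0 then c (Sum.inl i) * fderiv ℝ (fun y => g y i) xs v else 0 := by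
      split_ifs <;> simp
    simp only [hite] at hv
    linarith
  · dsimp only
    split_ifs
    exacts [hc _, le_rfl]
  · exact Finset.sum_eq_zero fun i _ => by by_cases hi : g xs i = 0 <;> simp [hi]
end
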